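/- (Stage 3 of Theorem 3.1, formula (3.15)) Let (f_Δ)_{Δ>0} be an approximate white-noise family with constants c > 0 and M > 0, and let g ∈ L¹(ℝ) be nonnegative and even. Then for all τ₁, τ₂ ∈ ℝ and all sequences T_n → ∞, Δ_n → ∞, the absolutely convergent double integrals satisfy (2π/c²) ∬_{ℝ²} e^{i(τ₁−τ₂)λ₂}·f_{Δ_n}(λ₁)·g(λ₂)·Φ_{T_n}(λ₂−λ₁) dλ₁ dλ₂ → (1/c) ∫_ℝ e^{i(τ₁−τ₂)λ}·g(λ) dλ as n → ∞. -/

import Mathlib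

open MeasureTheory Filter Set

noncomputable section

/-- The Fejér kernel on `ℝ`:
`Φ_T(λ) = (1/(2πT))·(sin(Tλ/2)/(λ/2))²` for `λ ≠ 0`, with `Φ_T(0) = T/(2π)`. -/
def fejer (T l : ℝ) : ℝ :=
  if l = 0 then T / (2 * Real.pi)
  else (1 / (2 * Real.pi * T)) * (Real.sin (T * l / 2) / (l / 2)) ^ 2

/-- A family `(f_Δ)_{Δ>0}` of measurable functions `f_Δ : ℝ → ℝ` is an *approximate
white-noise family* with constants `c > 0` and `M > 0` if `0 ≤ f_Δ ≤ M`, each `f_Δ` is even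
and Lebesgue integrable, and for every `a > 0`,
`sup_{|λ|≤a} |f_Δ(λ) − c/(2π)| → 0` as `Δ → ∞` (conditions (2.1a)–(2.1д)). -/
def ApproxWhiteNoise (f : ℝ → ℝ → ℝ) (c M : ℝ) : Prop :=
  0 < c ∧ 0 < M ∧
  (∀ Δ : ℝ, 0 < Δ → Measurable (f Δ)) ∧
  (∀ Δ : ℝ, 0 < Δ → ∀ l : ℝ, 0 ≤ f Δ l ∧ f Δ l ≤ M) ∧
  (∀ Δ : ℝ, 0 < Δ → ∀ l : ℝ, f Δ (-l) = f Δ l) ∧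
  (∀ Δ : ℝ, 0 < Δ → Integrable (f Δ)) ∧
  (∀ a : ℝ, 0 < a → ∀ ε : ℝ, 0 < ε → ∃ Δ₀ : ℝ, ∀ Δ : ℝ, Δ₀ ≤ Δ →
    ∀ l : ℝ, |l| ≤ a → |f Δ l - c / (2 * Real.pi)| ≤ ε)

lemma fejer_meas (T : ℝ) : Measurable (fejer T) := by
  unfold fejer
  refine Measurable.ite (measurableSet_singleton 0) measurable_const ?_
  fun_prop

lemma fejer_nonneg {T : ℝ} (hT : 0 < T) (l : ℝ) : 0 ≤ fejer T l := by
  unfold fejer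
  split_ifs <;> positivity

lemma fejer_le {T : ℝ} (hT : 0 < T) (l : ℝ) : fejer T l ≤ T / (2 * Real.pi) := by
  unfold fejer
  split_ifs with h
  · exact le_rfl
  · have h1 : Real.sin (T * l / 2) ^ 2 ≤ (T * l / 2) ^ 2 := Real.sin_sq_le_sq
    have h2 : (Real.sin (T * l / 2) / (l / 2)) ^ 2 ≤ T ^ 2 := by
      rw [div_pow, div_le_iff₀ (by positivity)]
      calc _ ≤ _ := h1
        _ = _ := by ring
    calc _ ≤ (1 / (2 * Real.pi * T)) * T ^ 2 := by gcongr
      _ = _ := by field_simp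

lemma fejer_scale {T : ℝ} (hT : 0 < T) (u : ℝ) : fejer T (u / T) = T * fejer 1 u := by
  unfold fejer
  by_cases h : u = 0
  · simp [h]; ring
  · have : u / T ≠ 0 := by positivity
    rw [if_neg this, if_neg h]
    have e : T * (u / T) / 2 = 1 * u / 2 := by field_simp
    rw [e]
    field_simp

lemma fejer_one_integrable : Integrable (fejer 1) := by
  refine integrable_inv_one_add_sq.mono' (fejer_meas 1).aestronglyMeasurable ?_
  refine Eventually.of_forall fun l => ?_
  rw [Real.norm_of_nonneg (fejer_nonneg one_pos l)]
  rw [inv_eq_one_div, le_div_iff₀ (by positivity)]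
  have hp := Real.pi_gt_three
  have h1 := fejer_le one_pos l
  have h2 : fejer 1 l * l ^ 2 ≤ 4 / (2 * Real.pi) := by
    unfold fejer
    split_ifs with h
    · simp [h]; positivity
    · have : (1 / (2 * Real.pi * 1)) * (Real.sin (1 * l / 2) / (l / 2)) ^ 2 * l ^ 2
          = 4 * Real.sin (1 * l / 2) ^ 2 / (2 * Real.pi) := by
        field_simp
        ring
      rw [this]
      gcongr
      nlinarith [Real.sin_sq_le_one (1 * l / 2)]
  have h3 : 1 / (2 * Real.pi) + 4 / (2 * Real.pi) ≤ 1 := by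
    rw [← add_div, div_le_one (by positivity)]; linarith
  nlinarith

def tent (v : ℝ) : ℂ := ((max 0 (1 - |v|) : ℝ) : ℂ)

lemma tent_cont : Continuous tent := by
  unfold tent; fun_prop

lemma tent_supp {v : ℝ} (h : v ∉ Ioc (-1 : ℝ) 1) : tent v = 0 := by
  have : 1 ≤ |v| := by
    by_contra h'
    push Not at h'
    rw [abs_lt] at h'
    exact h ⟨h'.1, h'.2.le⟩
  unfold tent
  rw [max_eq_left (by linarith)]; simp

lemma tent_integrable : Integrable tent := by
  have h : IntegrableOn tent (Ioc (-1) 1) := by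
    rw [← intervalIntegrable_iff_integrableOn_Ioc_of_le (by norm_num)]
    exact tent_cont.intervalIntegrable _ _
  exact (integrableOn_iff_integrable_of_support_subset (fun v hv => by
    by_contra h'; exact hv (tent_supp h'))).1 h

lemma tent_int (b : ℂ) (hb : b ≠ 0) :
    ∫ v : ℝ, Complex.exp (b * v) * tent v
      = (Complex.exp b + Complex.exp (-b) - 2) / b ^ 2 := by
  have hc : Continuous fun v : ℝ => Complex.exp (b * v) * tent v := by
    have := tent_cont; fun_prop
  have e1 : ∫ v : ℝ, Complex.exp (b * v) * tent v
      = ∫ v in (-1 : ℝ)..1, Complex.exp (b * v) * tent v := by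
    rw [intervalIntegral.integral_of_le (by norm_num),
      setIntegral_eq_integral_of_forall_compl_eq_zero]
    intro v hv
    rw [tent_supp hv, mul_zero]
  rw [e1, ← intervalIntegral.integral_add_adjacent_intervals (b := (0 : ℝ))
    (hc.intervalIntegrable _ _) (hc.intervalIntegrable _ _)]
  have hexp : ∀ v : ℝ, HasDerivAt (fun v : ℝ => Complex.exp (b * v)) (Complex.exp (b * v) * b) v := by
    intro v
    have := ((Complex.ofRealCLM.hasDerivAt (x := v)).const_mul b).cexp
    simpa using this
  have hid : ∀ v : ℝ, HasDerivAt (fun v : ℝ => (v : ℂ)) 1 v := fun v => by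
    simpa using (hasDerivAt_id v).ofReal_comp
  have i1 : ∫ v in (-1 : ℝ)..0, Complex.exp (b * v) * tent v
      = 1 / b - 1 / b ^ 2 + Complex.exp (-b) / b ^ 2 := by
    rw [intervalIntegral.integral_eq_sub_of_hasDerivAt
      (f := fun v : ℝ => (1 + (v : ℂ)) * Complex.exp (b * v) / b - Complex.exp (b * v) / b ^ 2)
      _ (hc.intervalIntegrable _ _)]
    · simp
    · intro v hv
      rw [uIcc_of_le (by norm_num)] at hv
      have ht : tent v = 1 + v := by
        unfold tent
        rw [abs_of_nonpos hv.2, max_eq_right (by linarith [hv.1])]; push_cast; ring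
      rw [ht]
      refine HasDerivAt.congr_deriv (((((hid v).const_add 1).mul (hexp v)).div_const b).sub ((hexp v).div_const (b ^ 2))) ?_
      field_simp
      ring
  have i2 : ∫ v in (0 : ℝ)..1, Complex.exp (b * v) * tent v
      = Complex.exp b / b ^ 2 - 1 / b - 1 / b ^ 2 := by
    rw [intervalIntegral.integral_eq_sub_of_hasDerivAt
      (f := fun v : ℝ => (1 - (v : ℂ)) * Complex.exp (b * v) / b + Complex.exp (b * v) / b ^ 2)
      _ (hc.intervalIntegrable _ _)]
    · simp; ring
    · intro v hv
      rw [uIcc_of_le (by norm_num)] at hv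
      have ht : tent v = 1 - v := by
        unfold tent
        rw [abs_of_nonneg hv.1, max_eq_right (by linarith [hv.2])]; push_cast; ring
      rw [ht]
      refine HasDerivAt.congr_deriv (((((hid v).const_sub 1).mul (hexp v)).div_const b).add ((hexp v).div_const (b ^ 2))) ?_
      field_simp
      ring
  rw [i1, i2]
  field_simp; ring

open FourierTransform in
lemma tent_fourier (w : ℝ) (hw : w ≠ 0) :
    𝓕 tent w = ((2 * Real.pi * fejer 1 (2 * Real.pi * w) : ℝ) : ℂ) := by
  rw [Real.fourier_real_eq_integral_exp_smul]
  have hp := Real.pi_pos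
  have hpc : (Real.pi : ℂ) ≠ 0 := by exact_mod_cast hp.ne'
  have hwc : (w : ℂ) ≠ 0 := by exact_mod_cast hw
  have hb : (-(2 * Real.pi * w : ℝ) * Complex.I : ℂ) ≠ 0 := by
    simp [hw, hp.ne']
  have := tent_int _ hb
  have e : ∀ v : ℝ, Complex.exp (↑(-2 * Real.pi * v * w) * Complex.I) • tent v
    = Complex.exp ((-(2 * Real.pi * w : ℝ) * Complex.I : ℂ) * v) * tent v := by
    intro v
    rw [smul_eq_mul]; congr 2; push_cast; ring
  simp_rw [e]
  rw [this]
  have hne : 2 * Real.pi * w ≠ 0 := by positivity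
  unfold fejer
  rw [if_neg hne]
  have h2 : Complex.exp (-(2 * Real.pi * w : ℝ) * Complex.I)
      + Complex.exp (-(-(2 * Real.pi * w : ℝ) * Complex.I)) = 
      ((2 * Real.cos (2 * Real.pi * w) : ℝ) : ℂ) := by
    push_cast
    rw [Complex.two_cos]; push_cast; rw [add_comm]; congr 2; ring
  have h3 : Real.cos (2 * Real.pi * w) = 1 - 2 * Real.sin (1 * (2 * Real.pi * w) / 2) ^ 2 := by
    have : 2 * Real.pi * w = 2 * (1 * (2 * Real.pi * w) / 2) := by ring
    rw [this, Real.cos_two_mul, Real.cos_sq']; ring_nf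
  rw [h2, h3, mul_pow, Complex.I_sq]
  push_cast
  field_simp; ring

open FourierTransform in
lemma fejer_one_integral : ∫ u, fejer 1 u = 1 := by
  have hp := Real.pi_pos
  have hae : (𝓕 tent) =ᵐ[volume] fun w => ((2 * Real.pi * fejer 1 (2 * Real.pi * w) : ℝ) : ℂ) := by
    have : ∀ᵐ w : ℝ, w ≠ 0 := by
      simp [ae_iff]
    filter_upwards [this] with w hw using tent_fourier w hw
  have hi : Integrable (𝓕 tent) := by
    rw [integrable_congr hae]
    exact ((fejer_one_integrable.comp_mul_left' (by positivity)).const_mul _).ofReal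
  have h := tent_integrable.fourierInv_fourier_eq hi tent_cont.continuousAt (v := 0)
  rw [Real.fourierInv_eq'] at h
  simp only [inner_zero_right, mul_zero, Complex.ofReal_zero, zero_mul, Complex.exp_zero, one_smul] at h
  rw [integral_congr_ae hae, integral_complex_ofReal, integral_const_mul,
    Measure.integral_comp_mul_left] at h
  have ht : tent 0 = 1 := by simp [tent]
  rw [ht] at h
  have h' := Complex.ofReal_eq_one.1 h
  rw [abs_of_pos (by positivity), smul_eq_mul] at h'
  rwa [← mul_assoc, mul_inv_cancel₀ (by positivity), one_mul] at h'

lemma main_integrable {f : ℝ → ℝ} (hfi : Integrable f)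
    {g : ℝ → ℝ} (hg1 : Integrable g) (t : ℝ) {T : ℝ} (hT : 0 < T) :
    Integrable (fun p : ℝ × ℝ =>
        Complex.exp (Complex.I * ((t * p.2 : ℝ) : ℂ))
          * ((f p.1 * g p.2 * fejer T (p.2 - p.1) : ℝ) : ℂ)) := by
  have h1 : Integrable (fun p : ℝ × ℝ => f p.1 * g p.2) := hfi.mul_prod hg1
  have h2 : Integrable (fun p : ℝ × ℝ => f p.1 * g p.2 * fejer T (p.2 - p.1)) := by
    refine h1.mul_bdd (c := T / (2 * Real.pi)) ?_ ?_
    · exact ((fejer_meas T).comp (measurable_snd.sub measurable_fst)).aestronglyMeasurable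
    · refine Eventually.of_forall fun p => ?_
      rw [Real.norm_of_nonneg (fejer_nonneg hT _)]
      exact fejer_le hT _
  refine (h2.ofReal (𝕜 := ℂ)).bdd_mul (c := 1) ?_ ?_
  · exact Continuous.aestronglyMeasurable (by fun_prop)
  · refine Eventually.of_forall fun p => ?_
    rw [mul_comm, Complex.norm_exp_ofReal_mul_I]

lemma inner_eq (f : ℝ → ℝ) {T : ℝ} (hT : 0 < T) (y : ℝ) :
    ∫ x, f x * fejer T (y - x) = ∫ u, f (y - u / T) * fejer 1 u := by
  rw [← integral_sub_left_eq_self (fun x => f x * fejer T (y - x)) volume y]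
  have := Measure.integral_comp_div (fun x => f (y - x) * fejer T (y - (y - x))) T
  simp only [sub_sub_cancel] at this ⊢
  simp_rw [fejer_scale hT] at this
  rw [abs_of_pos hT, smul_eq_mul] at this
  have e : ∀ u, f (y - u / T) * (T * fejer 1 u) = T * (f (y - u / T) * fejer 1 u) := by
    intro u; ring
  simp_rw [e, integral_const_mul] at this
  exact (mul_left_cancel₀ hT.ne' this).symm

theorem stmt10 (f : ℝ → ℝ → ℝ) (c M : ℝ) (hf : ApproxWhiteNoise f c M)
    (g : ℝ → ℝ) (hg1 : Integrable g) (hg0 : ∀ l : ℝ, 0 ≤ g l)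
    (hgeven : ∀ l : ℝ, g (-l) = g l) (τ₁ τ₂ : ℝ)
    (T Δ : ℕ → ℝ) (hT : Tendsto T atTop atTop) (hΔ : Tendsto Δ atTop atTop) :
    (∀ n : ℕ, 0 < T n → 0 < Δ n →
      Integrable (fun p : ℝ × ℝ =>
        Complex.exp (Complex.I * (((τ₁ - τ₂) * p.2 : ℝ) : ℂ))
          * ((f (Δ n) p.1 * g p.2 * fejer (T n) (p.2 - p.1) : ℝ) : ℂ))) ∧
    Tendsto (fun n : ℕ => ((2 * Real.pi / c ^ 2 : ℝ) : ℂ) *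
        ∫ p : ℝ × ℝ,
          Complex.exp (Complex.I * (((τ₁ - τ₂) * p.2 : ℝ) : ℂ))
            * ((f (Δ n) p.1 * g p.2 * fejer (T n) (p.2 - p.1) : ℝ) : ℂ))
      atTop
      (nhds (((1 / c : ℝ) : ℂ) *
        ∫ l : ℝ, Complex.exp (Complex.I * (((τ₁ - τ₂) * l : ℝ) : ℂ)) * ((g l : ℝ) : ℂ))) := by
  obtain ⟨hc, hM, hmeas, hbd, -, hfint, hunif⟩ := hf
  have hI : ∀ n : ℕ, 0 < T n → 0 < Δ n →
      Integrable (fun p : ℝ × ℝ =>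
        Complex.exp (Complex.I * (((τ₁ - τ₂) * p.2 : ℝ) : ℂ))
          * ((f (Δ n) p.1 * g p.2 * fejer (T n) (p.2 - p.1) : ℝ) : ℂ)) :=
    fun n h1 h2 => main_integrable (hfint _ h2) hg1 _ h1
  refine ⟨hI, ?_⟩
  set E : ℝ → ℂ := fun y => Complex.exp (Complex.I * (((τ₁ - τ₂) * y : ℝ) : ℂ)) with hE
  have hTpos : ∀ᶠ n in atTop, 1 ≤ T n := hT.eventually_ge_atTop 1
  have hΔpos : ∀ᶠ n in atTop, 0 < Δ n := hΔ.eventually_gt_atTop 0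
  -- inner averages
  set h : ℕ → ℝ → ℝ := fun n y => ∫ u, f (Δ n) (y - u / T n) * fejer 1 u with hh
  have hconst : ∀ a : ℝ, ∫ u, a * fejer 1 u = a := by
    intro a; rw [integral_const_mul, fejer_one_integral, mul_one]
  have hlim : ∀ y, Tendsto (fun n => h n y) atTop (nhds (c / (2 * Real.pi))) := by
    intro y
    rw [← hconst (c / (2 * Real.pi))]
    refine tendsto_integral_filter_of_dominated_convergence (fun u => M * fejer 1 u) ?_ ?_
      (fejer_one_integrable.const_mul M) ?_
    · filter_upwards [hΔpos] with n hn
      exact (((hmeas _ hn).comp (by fun_prop)).mul (fejer_meas 1)).aestronglyMeasurable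
    · filter_upwards [hΔpos] with n hn
      refine Eventually.of_forall fun u => ?_
      rw [Real.norm_of_nonneg (mul_nonneg (hbd _ hn _).1 (fejer_nonneg one_pos u))]
      exact mul_le_mul_of_nonneg_right (hbd _ hn _).2 (fejer_nonneg one_pos u)
    · refine Eventually.of_forall fun u => ?_
      refine Tendsto.mul_const _ ?_
      rw [Metric.tendsto_nhds]
      intro ε hε
      obtain ⟨D, hD⟩ := hunif (|y| + |u| + 1) (by positivity) (ε / 2) (by positivity)
      filter_upwards [hTpos, hΔ.eventually_ge_atTop D] with n h1 h2
      rw [Real.dist_eq]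
      refine (hD _ h2 _ ?_).trans_lt (by linarith)
      have h3 : |u / T n| ≤ |u| := by
        rw [abs_div, abs_of_pos (by linarith : 0 < T n)]
        exact div_le_self (abs_nonneg _) h1
      linarith [abs_sub y (u / T n)]
  have hhb : ∀ᶠ n in atTop, ∀ y, ‖h n y‖ ≤ M := by
    filter_upwards [hΔpos] with n hn y
    rw [← hconst M]
    refine norm_integral_le_of_norm_le (fejer_one_integrable.const_mul M) ?_
    refine Eventually.of_forall fun u => ?_
    rw [Real.norm_of_nonneg (mul_nonneg (hbd _ hn _).1 (fejer_nonneg one_pos u))]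
    exact mul_le_mul_of_nonneg_right (hbd _ hn _).2 (fejer_nonneg one_pos u)
  have hin : ∀ n, 0 < T n → ∀ y, ∫ x, E y * ((f (Δ n) x * g y * fejer (T n) (y - x) : ℝ) : ℂ)
      = E y * ((g y * h n y : ℝ) : ℂ) := by
    intro n hn y
    rw [integral_const_mul, integral_complex_ofReal, hh]
    simp only
    rw [← inner_eq _ hn, ← integral_const_mul]
    congr 3
    ext x; ring
  have key : Tendsto (fun n => ∫ y, E y * ((g y * h n y : ℝ) : ℂ)) atTop
      (nhds (∫ y, E y * ((g y * (c / (2 * Real.pi)) : ℝ) : ℂ))) := by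
    refine tendsto_integral_filter_of_dominated_convergence (fun y => g y * M) ?_ ?_
      (hg1.mul_const M) ?_
    · filter_upwards [hΔpos, hTpos] with n h1 h2
      have := (hI n (by linarith) h1).integral_prod_right
      simp_rw [← hin n (by linarith)]
      exact this.aestronglyMeasurable
    · filter_upwards [hhb] with n hn
      refine Eventually.of_forall fun y => ?_
      rw [norm_mul, hE]
      simp only
      rw [mul_comm Complex.I, Complex.norm_exp_ofReal_mul_I, one_mul, Complex.norm_real, norm_mul,
        Real.norm_of_nonneg (hg0 y)]
      exact mul_le_mul_of_nonneg_left (hn y) (hg0 y)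
    · refine Eventually.of_forall fun y => ?_
      refine Tendsto.const_mul _ ?_
      exact (Complex.continuous_ofReal.tendsto _).comp ((hlim y).const_mul (g y))
  have hval : ((1 / c : ℝ) : ℂ) * ∫ l : ℝ, E l * ((g l : ℝ) : ℂ)
      = ((2 * Real.pi / c ^ 2 : ℝ) : ℂ) * ∫ y, E y * ((g y * (c / (2 * Real.pi)) : ℝ) : ℂ) := by
    have e : ∀ y, E y * ((g y * (c / (2 * Real.pi)) : ℝ) : ℂ)
        = (E y * (g y : ℂ)) * ((c / (2 * Real.pi) : ℝ) : ℂ) := by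
      intro y; push_cast; ring
    simp_rw [e]
    rw [integral_mul_const]
    have e2 : (1 / c : ℝ) = (2 * Real.pi / c ^ 2) * (c / (2 * Real.pi)) := by
      have := Real.pi_pos
      field_simp
    rw [e2, Complex.ofReal_mul]; ring
  rw [hval]
  refine (key.const_mul _).congr' ?_
  filter_upwards [hΔpos, hTpos] with n h1 h2
  congr 1
  rw [Measure.volume_eq_prod, integral_prod_symm _ (hI n (by linarith) h1)]
  exact (integral_congr_ae (Eventually.of_forall fun y => hin n (by linarith) y)).symm
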